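/- arXiv:2003.08105 — 4 statements merged into one kernel-verified Lean document; each statement's English description precedes it below -/
import Mathlib

section
/- Let T₀ ≥ 0, α > 0 and 0 < δ < 1. Let y : [0,∞) → ℝ be locally absolutely continuous (y ∈ W^{1,1}_loc([0,∞);ℝ)) with y(t) ≥ 0 for all t ≥ 0, and suppose that y′(t) + 2α·y(t)^δ ≤ 0 for almost every t > T₀. Then for every t ≥ T₀, y(t) ≤ ( max{ y(T₀)^{1−δ} + 2α(1−δ)(T₀ − t), 0 } )^{1/(1−δ)}. In particular, y(t) = 0 for every t ≥ T⋆, where T⋆ = T₀ + y(T₀)^{1−δ} / (2α(1−δ)). -/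
open MeasureTheory

/-- Tangent line bound for the concave power function `x ↦ x ^ p`, `0 ≤ p ≤ 1`. -/
lemma rpow_sub_rpow_le_mul_sub {p a b : ℝ} (hp0 : 0 ≤ p) (hp1 : p ≤ 1) (ha : 0 < a)
    (hb : 0 ≤ b) : b ^ p - a ^ p ≤ p * a ^ (p - 1) * (b - a) := by
  have h := rpow_one_add_le_one_add_mul_self (s := b / a - 1)
    (by have := div_nonneg hb ha.le; linarith) hp0 hp1
  rw [add_sub_cancel, Real.div_rpow hb ha.le,
    div_le_iff₀ (Real.rpow_pos_of_pos ha p)] at h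
  rw [Real.rpow_sub_one ha.ne']
  calc b ^ p - a ^ p ≤ (1 + p * (b / a - 1)) * a ^ p - a ^ p := by linarith
    _ = p * (a ^ p / a) * (b - a) := by field_simp; ring

/-- A continuous positive function on `[a, b]` decreasing at least at the rate `k * y ^ δ`
satisfies the linear decay bound for `y ^ (1 - δ)`. -/
lemma rpow_one_sub_le_of_decay {a b k δ : ℝ} {y : ℝ → ℝ} (hδ0 : 0 ≤ δ)
    (hδ1 : δ ≤ 1) (hab : a ≤ b) (hc : ContinuousOn y (Set.Icc a b))
    (hpos : ∀ t ∈ Set.Icc a b, 0 < y t)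
    (hdec : ∀ s t, a ≤ s → s ≤ t → t ≤ b → y t ≤ y s - k * y t ^ δ * (t - s)) :
    y b ^ (1 - δ) ≤ y a ^ (1 - δ) + k * (1 - δ) * (a - b) := by
  refine image_le_of_liminf_slope_right_le_deriv_boundary (f := fun t => y t ^ (1 - δ))
    (a := a) (b := b) (B := fun t => y a ^ (1 - δ) + k * (1 - δ) * (a - t))
    (B' := fun _ => -(k * (1 - δ))) ?_ ?_ ?_ ?_ ?_ (Set.right_mem_Icc.2 hab)
  · exact hc.rpow_const fun t ht => Or.inl (hpos t ht).ne'
  · simp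
  · fun_prop
  · intro x _
    have h := (((hasDerivAt_id x).const_sub a).const_mul (k * (1 - δ))).const_add (y a ^ (1 - δ))
    simpa using h.hasDerivWithinAt (s := Set.Ici x)
  · intro x hx r hr
    have hyx := hpos x ⟨hx.1, hx.2.le⟩
    have hlim : Filter.Tendsto (fun z => -(k * (1 - δ) * (y x ^ (-δ) * y z ^ δ)))
        (nhdsWithin x (Set.Ioi x)) (nhds (-(k * (1 - δ) * (y x ^ (-δ) * y x ^ δ)))) := by
      have h1 : Filter.Tendsto y (nhdsWithin x (Set.Ioi x)) (nhds (y x)) := by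
        refine (hc x ⟨hx.1, hx.2.le⟩).mono_left ?_
        rw [← nhdsWithin_Ioc_eq_nhdsGT hx.2]
        exact nhdsWithin_mono _ fun z hz => ⟨hx.1.trans hz.1.le, hz.2⟩
      exact (((h1.rpow_const (Or.inl hyx.ne')).const_mul _).const_mul _).neg
    rw [← Real.rpow_add hyx, neg_add_cancel, Real.rpow_zero, mul_one] at hlim
    refine Filter.Eventually.frequently ?_
    filter_upwards [hlim.eventually (gt_mem_nhds hr), Ioc_mem_nhdsGT hx.2] with z hz hxz
    refine lt_of_le_of_lt ?_ hz
    have hzx : 0 < z - x := sub_pos.2 hxz.1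
    rw [slope_def_field, div_le_iff₀ hzx]
    have h1 := rpow_sub_rpow_le_mul_sub (sub_nonneg.2 hδ1) (by linarith : 1 - δ ≤ 1) hyx
      (hpos z ⟨hx.1.trans hxz.1.le, hxz.2⟩).le
    have h2 := hdec x z hx.1 hxz.1.le hxz.2
    have h3 : 0 ≤ (1 - δ) * y x ^ (-δ) :=
      mul_nonneg (sub_nonneg.2 hδ1) (Real.rpow_nonneg hyx.le _)
    rw [show 1 - δ - 1 = -δ by ring] at h1
    calc _ ≤ _ := h1
      _ ≤ (1 - δ) * y x ^ (-δ) * (-(k * y z ^ δ * (z - x))) :=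
        mul_le_mul_of_nonneg_left (by linarith) h3
      _ = _ := by ring

theorem stmt9 (T₀ α δ : ℝ) (hT₀ : 0 ≤ T₀) (hα : 0 < α) (hδ0 : 0 < δ) (hδ1 : δ < 1)
    (y y' : ℝ → ℝ)
    (hy_nonneg : ∀ t, 0 ≤ t → 0 ≤ y t)
    (hy'_int : ∀ s t : ℝ, 0 ≤ s → s ≤ t → IntervalIntegrable y' volume s t)
    (hy_ftc : ∀ s t : ℝ, 0 ≤ s → s ≤ t → y t = y s + ∫ σ in s..t, y' σ)
    (hode : ∀ᵐ t : ℝ ∂volume, T₀ < t → y' t + 2 * α * y t ^ δ ≤ 0) :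
    (∀ t, T₀ ≤ t →
        y t ≤ max (y T₀ ^ (1 - δ) + 2 * α * (1 - δ) * (T₀ - t)) 0 ^ (1 / (1 - δ)))
    ∧ ∀ t, T₀ + y T₀ ^ (1 - δ) / (2 * α * (1 - δ)) ≤ t → y t = 0 := by
  have hp : 0 < 1 - δ := sub_pos.2 hδ1
  have hint_le : ∀ s t c, T₀ ≤ s → s ≤ t → (∀ σ, s ≤ σ → σ ≤ t → c ≤ y σ ^ δ) →
      y t ≤ y s - 2 * α * c * (t - s) := by
    intro s t c hs hst hcσ
    have h : ∫ σ in s..t, y' σ ≤ ∫ _ in s..t, -(2 * α * c) := by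
      refine intervalIntegral.integral_mono_ae_restrict hst (hy'_int s t (hT₀.trans hs) hst)
        intervalIntegrable_const ?_
      rw [← restrict_Ioc_eq_restrict_Icc]
      filter_upwards [ae_restrict_of_ae hode, ae_restrict_mem measurableSet_Ioc] with σ hσ hm
      have h1 := hσ (hs.trans_lt hm.1)
      have h2 := mul_le_mul_of_nonneg_left (hcσ σ hm.1.le hm.2) (by positivity : 0 ≤ 2 * α)
      linarith
    rw [intervalIntegral.integral_const, smul_eq_mul] at h
    rw [hy_ftc s t (hT₀.trans hs) hst]
    linarith
  have hanti : ∀ s t, T₀ ≤ s → s ≤ t → y t ≤ y s := by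
    intro s t hs hst
    simpa using hint_le s t 0 hs hst fun σ hσ _ =>
      Real.rpow_nonneg (hy_nonneg σ (hT₀.trans (hs.trans hσ))) _
  have hbound : ∀ t, T₀ ≤ t →
      y t ≤ max (y T₀ ^ (1 - δ) + 2 * α * (1 - δ) * (T₀ - t)) 0 ^ (1 / (1 - δ)) := by
    intro t ht
    rcases (hy_nonneg t (hT₀.trans ht)).eq_or_lt with h0 | hpos
    · rw [← h0]; positivity
    have hcont : ContinuousOn y (Set.Icc T₀ t) := by
      have h := intervalIntegral.continuousOn_primitive_interval
        ((intervalIntegrable_iff_integrableOn_Icc_of_le ht).1 (hy'_int T₀ t hT₀ ht) |>.mono_set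
          (Set.uIcc_of_le ht).subset)
      rw [Set.uIcc_of_le ht] at h
      exact (continuousOn_const.add h).congr fun s hs => hy_ftc T₀ s hT₀ hs.1
    have key := rpow_one_sub_le_of_decay hδ0.le hδ1.le ht hcont
      (fun s hs => hpos.trans_le (hanti s t hs.1 hs.2))
      (fun s r hs hsr _ => hint_le s r _ hs hsr fun σ hσ hσr =>
        Real.rpow_le_rpow (hy_nonneg r (hT₀.trans (hs.trans hsr)))
          (hanti σ r (hs.trans hσ) hσr) hδ0.le)
    calc y t = (y t ^ (1 - δ)) ^ (1 / (1 - δ)) := by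
          rw [one_div, Real.rpow_rpow_inv hpos.le hp.ne']
      _ ≤ _ := Real.rpow_le_rpow (Real.rpow_nonneg hpos.le _) (key.trans (le_max_left _ _))
          (by positivity)
  refine ⟨hbound, fun t ht => ?_⟩
  have hk : 0 < 2 * α * (1 - δ) := by positivity
  have hT : T₀ ≤ t := by
    have := div_nonneg (Real.rpow_nonneg (hy_nonneg T₀ hT₀) (1 - δ)) hk.le
    linarith
  have hle : y T₀ ^ (1 - δ) + 2 * α * (1 - δ) * (T₀ - t) ≤ 0 := by
    have := (div_le_iff₀ hk).1 (le_sub_iff_add_le'.2 ht)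
    linarith
  have h := hbound t hT
  rw [max_eq_right hle, Real.zero_rpow (one_div_pos.2 hp).ne'] at h
  exact h.antisymm (hy_nonneg t (hT₀.trans hT))
end

section
/- Let T₀ ≥ 0, α > 0 and δ > 1. Let y : [0,∞) → ℝ be locally absolutely continuous (y ∈ W^{1,1}_loc([0,∞);ℝ)) with y(t) ≥ 0 for all t ≥ 0, and suppose that y′(t) + 2α·y(t)^δ ≤ 0 for almost every t > T₀. Then for every t ≥ T₀, y(t) ≤ y(T₀) / ( 1 + 2α(δ−1)·y(T₀)^{δ−1}·(t−T₀) )^{1/(δ−1)}. -/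
open MeasureTheory

/-- The tangent line inequality for the convex function `x ↦ x ^ (-p)`. -/
lemma mul_rpow_mul_sub_le_rpow_neg_sub {a b p : ℝ} (ha : 0 < a) (hb : 0 < b) (hp : 0 ≤ p) :
    p * a ^ (-(p + 1)) * (a - b) ≤ b ^ (-p) - a ^ (-p) := by
  have hu : 0 < b / a := div_pos hb ha
  have h1 : 1 + p * (1 - b / a) ≤ (b / a) ^ (-p) := by
    rw [Real.rpow_def_of_pos hu]
    have h2 := Real.add_one_le_exp (Real.log (b / a) * -p)
    have h3 := mul_le_mul_of_nonneg_left (Real.log_le_sub_one_of_pos hu) hp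
    linarith
  have hap : 0 < a ^ (-p) := Real.rpow_pos_of_pos ha _
  have h4 : a ^ (-(p + 1)) = a ^ (-p) / a := by
    rw [← Real.rpow_sub_one ha.ne']; ring_nf
  rw [Real.div_rpow hb.le ha.le, le_div_iff₀ hap] at h1
  rw [h4]
  have h5 : p * (a ^ (-p) / a) * (a - b) = p * (1 - b / a) * a ^ (-p) := by
    field_simp
  linarith

/-- If a positive continuous `y` decreases by at least `c * y t ^ (p + 1) * (t - s)` between any
`s ≤ t`, then `y ^ (-p)` grows at least linearly, with slope `c * p`. -/
lemma rpow_neg_add_le_of_sub_le {y : ℝ → ℝ} {a b c p : ℝ} (hab : a ≤ b) (hp : 0 ≤ p)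
    (hcont : ContinuousOn y (Set.Icc a b)) (hpos : ∀ s ∈ Set.Icc a b, 0 < y s)
    (hstep : ∀ s ∈ Set.Icc a b, ∀ t ∈ Set.Icc a b, s ≤ t →
      c * y t ^ (p + 1) * (t - s) ≤ y s - y t) :
    y a ^ (-p) + c * p * (b - a) ≤ y b ^ (-p) := by
  have key : ∀ ⦃x⦄, x ∈ Set.Icc a b → -(y x ^ (-p)) ≤ -(y a ^ (-p)) - c * p * (x - a) := by
    refine image_le_of_liminf_slope_right_le_deriv_boundary (B' := fun _ => -(c * p))
      (hcont.rpow_const fun s hs => Or.inl (hpos s hs).ne').neg (by simp) (by fun_prop) ?_ ?_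
    · intro x _
      refine HasDerivAt.hasDerivWithinAt ?_
      simpa using (((hasDerivAt_id x).sub_const a).const_mul (c * p)).const_sub (-(y a ^ (-p)))
    · intro x hx r hr
      have hxm : x ∈ Set.Icc a b := ⟨hx.1, hx.2.le⟩
      have hyx := hpos x hxm
      have hmem : ∀ᶠ z in nhdsWithin x (Set.Ioi x), z ∈ Set.Ioc x b :=
        Ioc_mem_nhdsGT hx.2
      have hyt : Filter.Tendsto y (nhdsWithin x (Set.Ioi x)) (nhds (y x)) :=
        (hcont x hxm).mono_left (nhdsWithin_le_of_mem
          (Filter.mem_of_superset (Ioc_mem_nhdsGT hx.2) fun z hz => ⟨hx.1.trans hz.1.le, hz.2⟩))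
      have hlim : Filter.Tendsto (fun z => -(p * y x ^ (-(p + 1)) * (c * y z ^ (p + 1))))
          (nhdsWithin x (Set.Ioi x)) (nhds (-(c * p))) := by
        have h := (((hyt.rpow_const (p := p + 1) (Or.inl hyx.ne')).const_mul c).const_mul
          (p * y x ^ (-(p + 1)))).neg
        convert h using 2
        rw [Real.rpow_neg hyx.le]
        have := (Real.rpow_pos_of_pos hyx (p + 1)).ne'
        field_simp
      refine Filter.Eventually.frequently ?_
      filter_upwards [hmem, hlim.eventually_lt_const hr] with z hz hzr
      refine lt_of_le_of_lt ?_ hzr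
      have hzm : z ∈ Set.Icc a b := ⟨hx.1.trans hz.1.le, hz.2⟩
      have hzx : 0 < z - x := sub_pos.2 hz.1
      rw [slope_def_field, div_le_iff₀ hzx]
      simp only [Pi.neg_apply]
      have h1 := mul_rpow_mul_sub_le_rpow_neg_sub hyx (hpos z hzm) hp
      have h2 := mul_le_mul_of_nonneg_left (hstep x hxm z hzm hz.1.le)
        (mul_nonneg hp (Real.rpow_nonneg hyx.le (-(p + 1))))
      linarith
  have := key (Set.right_mem_Icc.2 hab)
  linarith

theorem stmt11 (T₀ α δ : ℝ) (hT₀ : 0 ≤ T₀) (hα : 0 < α) (hδ : 1 < δ)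
    (y y' : ℝ → ℝ)
    (hy_nonneg : ∀ t, 0 ≤ t → 0 ≤ y t)
    (hy'_int : ∀ s t : ℝ, 0 ≤ s → s ≤ t → IntervalIntegrable y' volume s t)
    (hy_ftc : ∀ s t : ℝ, 0 ≤ s → s ≤ t → y t = y s + ∫ σ in s..t, y' σ)
    (hode : ∀ᵐ t : ℝ ∂volume, T₀ < t → y' t + 2 * α * y t ^ δ ≤ 0) :
    ∀ t, T₀ ≤ t →
      y t ≤ y T₀ / (1 + 2 * α * (δ - 1) * y T₀ ^ (δ - 1) * (t - T₀)) ^ (1 / (δ - 1)) := by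
  intro t ht
  have hp : 0 < δ - 1 := sub_pos.2 hδ
  have bound : ∀ C : ℝ, ∀ s u : ℝ, T₀ ≤ s → s ≤ u →
      (∀ σ ∈ Set.Ioc s u, C ≤ y σ ^ δ) → 2 * α * C * (u - s) ≤ y s - y u := by
    intro C s u hs hsu hC
    have hle : ∫ σ in s..u, y' σ ≤ ∫ _ in s..u, -(2 * α * C) := by
      refine intervalIntegral.integral_mono_ae_restrict hsu (hy'_int s u (hT₀.trans hs) hsu)
        intervalIntegrable_const ?_
      rw [← restrict_Ioc_eq_restrict_Icc]
      filter_upwards [ae_restrict_of_ae hode, ae_restrict_mem measurableSet_Ioc] with σ h hσ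
      have h1 := h (hs.trans_lt hσ.1)
      have h2 := mul_le_mul_of_nonneg_left (hC σ hσ) (by positivity : 0 ≤ 2 * α)
      linarith
    rw [intervalIntegral.integral_const, smul_eq_mul] at hle
    have := hy_ftc s u (hT₀.trans hs) hsu
    linarith
  have anti : ∀ s u : ℝ, T₀ ≤ s → s ≤ u → y u ≤ y s := by
    intro s u hs hsu
    have := bound 0 s u hs hsu fun σ hσ =>
      Real.rpow_nonneg (hy_nonneg σ (hT₀.trans (hs.trans hσ.1.le))) δ
    linarith
  have hy0 : 0 ≤ y T₀ := hy_nonneg _ hT₀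
  have hD : 0 ≤ 1 + 2 * α * (δ - 1) * y T₀ ^ (δ - 1) * (t - T₀) := by
    have := sub_nonneg.2 ht
    positivity
  rcases (hy_nonneg t (hT₀.trans ht)).eq_or_lt with h0 | hpos
  · rw [← h0]
    positivity
  have hcont : ContinuousOn y (Set.Icc T₀ t) := by
    have h := intervalIntegral.continuousOn_primitive_interval'
      (hy'_int T₀ t hT₀ ht) Set.left_mem_uIcc
    rw [Set.uIcc_of_le ht] at h
    exact (h.const_add (y T₀)).congr fun s hs => hy_ftc T₀ s hT₀ hs.1
  have hgrowth := rpow_neg_add_le_of_sub_le (c := 2 * α) ht hp.le hcont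
    (fun s hs => hpos.trans_le (anti s t hs.1 hs.2)) (by
      intro s hs u hu hsu
      rw [sub_add_cancel]
      exact bound _ s u hs.1 hsu fun σ hσ => Real.rpow_le_rpow
        (hy_nonneg u (hT₀.trans hu.1)) (anti σ u (hs.1.trans hσ.1.le) hσ.2) (by linarith))
  have hy0' : 0 < y T₀ := hpos.trans_le (anti T₀ t le_rfl ht)
  have hA : 0 < y T₀ ^ (δ - 1) := Real.rpow_pos_of_pos hy0' _
  have hDle : 1 + 2 * α * (δ - 1) * y T₀ ^ (δ - 1) * (t - T₀) ≤ (y T₀ / y t) ^ (δ - 1) := by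
    have h := mul_le_mul_of_nonneg_left hgrowth hA.le
    rw [mul_add, Real.rpow_neg hy0, Real.rpow_neg hpos.le, mul_inv_cancel₀ hA.ne'] at h
    rw [Real.div_rpow hy0 hpos.le, div_eq_mul_inv]
    linarith
  have hroot := Real.rpow_le_rpow hD hDle (one_div_nonneg.2 hp.le)
  rw [← Real.rpow_mul (div_nonneg hy0 hpos.le), mul_one_div_cancel hp.ne', Real.rpow_one,
    le_div_iff₀ hpos] at hroot
  rw [le_div_iff₀ (by have := sub_nonneg.2 ht; positivity)]
  linarith
end

section
/- Let δ ∈ (0,1), α > 0 and T₀ > 0. Set y⋆ = (α·δ^δ·(1−δ))^{1/(1−δ)} and x⋆ = (α·δ·(1−δ)·T₀)^{1/(1−δ)}. Let y : [0,∞) → ℝ be locally absolutely continuous (y ∈ W^{1,1}_loc([0,∞);ℝ)) with y(t) ≥ 0 for all t ≥ 0. If y(0) ≤ x⋆ and y′(t) + α·y(t)^δ ≤ y⋆ · (max{T₀ − t, 0})^{δ/(1−δ)} for almost every t > 0, then y(t) = 0 for every t ≥ T₀. -/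
open MeasureTheory

/-- A continuous function that starts nonpositive and cannot increase on any interval on which it
is positive stays nonpositive. -/
theorem nonpos_of_le_of_forall_Ioc_pos {w : ℝ → ℝ} {a b : ℝ}
    (hw : ContinuousOn w (Set.Icc a b)) (ha : w a ≤ 0)
    (hdec : ∀ s t, a ≤ s → s ≤ t → t ≤ b → (∀ x ∈ Set.Ioc s t, 0 < w x) → w t ≤ w s)
    {t : ℝ} (ht : t ∈ Set.Icc a b) : w t ≤ 0 := by
  have hsub : Set.Icc a t ⊆ Set.Icc a b := Set.Icc_subset_Icc_right ht.2
  have hcomp : IsCompact (Set.Icc a t ∩ w ⁻¹' Set.Iic 0) :=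
    isCompact_Icc.of_isClosed_subset
      ((hw.mono hsub).preimage_isClosed_of_isClosed isClosed_Icc isClosed_Iic)
      Set.inter_subset_left
  obtain ⟨s, ⟨hs, hws⟩, hmax⟩ := hcomp.exists_isGreatest ⟨a, Set.left_mem_Icc.2 ht.1, ha⟩
  refine (hdec s t hs.1 hs.2 ht.2 fun x hx => ?_).trans hws
  by_contra! hx0
  exact (hmax ⟨⟨hs.1.trans hx.1.le, hx.2⟩, hx0⟩).not_gt hx.1

/-- The function `t ↦ c * (T - t) ^ (1 / (1 - δ))` with `c = (α δ (1 - δ)) ^ (1 / (1 - δ))`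
solves `z' + α z ^ δ = (α δ ^ δ (1 - δ)) ^ (1 / (1 - δ)) * (T - t) ^ (δ / (1 - δ))`. -/
theorem extinction_profile_ode {δ α r : ℝ} (hδ : δ ∈ Set.Ioo (0 : ℝ) 1) (hα : 0 < α)
    (hr : 0 ≤ r) :
    (α * δ ^ δ * (1 - δ)) ^ (1 / (1 - δ)) * r ^ (δ / (1 - δ)) =
      -((α * δ * (1 - δ)) ^ (1 / (1 - δ)) * (1 / (1 - δ) * r ^ (δ / (1 - δ)))) +
        α * ((α * δ * (1 - δ)) ^ (1 / (1 - δ)) * r ^ (1 / (1 - δ))) ^ δ := by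
  obtain ⟨h0, h1⟩ := hδ
  have h1' : 0 < 1 - δ := sub_pos.2 h1
  have hk : 0 < α * δ * (1 - δ) := by positivity
  have hc : ((α * δ * (1 - δ)) ^ (1 / (1 - δ))) ^ δ =
      (α * δ * (1 - δ)) ^ (1 / (1 - δ)) / (α * δ * (1 - δ)) := by
    rw [← Real.rpow_mul hk.le, ← Real.rpow_sub_one hk.ne']
    congr 1
    field_simp
    ring
  have hy : (α * δ ^ δ * (1 - δ)) ^ (1 / (1 - δ)) = (α * δ * (1 - δ)) ^ (1 / (1 - δ)) / δ := by
    have hfac : α * δ ^ δ * (1 - δ) = α * δ * (1 - δ) * δ ^ (-(1 - δ)) := by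
      have : δ ^ δ = δ * δ ^ (-(1 - δ)) := by
        rw [← Real.rpow_one_add' h0.le (by simpa using h0.ne')]
        congr 1
        ring
      rw [this]
      ring
    rw [hfac, Real.mul_rpow hk.le (by positivity), ← Real.rpow_mul h0.le,
      show -(1 - δ) * (1 / (1 - δ)) = -1 by field_simp, Real.rpow_neg_one,
      ← div_eq_mul_inv]
  rw [hy, Real.mul_rpow (Real.rpow_nonneg hk.le _) (Real.rpow_nonneg hr _), hc, ← Real.rpow_mul hr,
    show 1 / (1 - δ) * δ = δ / (1 - δ) by ring]
  field_simp
  ring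

theorem stmt12 (δ α T₀ : ℝ) (hδ : δ ∈ Set.Ioo (0 : ℝ) 1) (hα : 0 < α) (hT₀ : 0 < T₀)
    (y y' : ℝ → ℝ)
    (hy_nonneg : ∀ t, 0 ≤ t → 0 ≤ y t)
    (hy'_int : ∀ s t : ℝ, 0 ≤ s → s ≤ t → IntervalIntegrable y' volume s t)
    (hy_ftc : ∀ s t : ℝ, 0 ≤ s → s ≤ t → y t = y s + ∫ σ in s..t, y' σ)
    (hy0 : y 0 ≤ (α * δ * (1 - δ) * T₀) ^ (1 / (1 - δ)))
    (hode : ∀ᵐ t : ℝ ∂volume, 0 < t →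
        y' t + α * y t ^ δ
          ≤ (α * δ ^ δ * (1 - δ)) ^ (1 / (1 - δ)) * max (T₀ - t) 0 ^ (δ / (1 - δ))) :
    ∀ t, T₀ ≤ t → y t = 0 := by
  have hδ0 : 0 < δ := hδ.1
  have h1 : 0 < 1 - δ := sub_pos.2 hδ.2
  have hp : 1 ≤ 1 / (1 - δ) := by rw [le_div_iff₀ h1]; linarith
  have hp1 : 1 / (1 - δ) - 1 = δ / (1 - δ) := by field_simp; ring
  have hq : 0 < δ / (1 - δ) := by positivity
  have hk : 0 < α * δ * (1 - δ) := by positivity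
  set c : ℝ := (α * δ * (1 - δ)) ^ (1 / (1 - δ)) with hc
  have hc0 : 0 < c := by positivity
  set z : ℝ → ℝ := fun t => c * (T₀ - t) ^ (1 / (1 - δ)) with hz
  set z' : ℝ → ℝ := fun t => -(c * (1 / (1 - δ) * (T₀ - t) ^ (δ / (1 - δ)))) with hz'
  have hzderiv (t : ℝ) : HasDerivAt z (z' t) t := by
    have := (((hasDerivAt_id' t).const_sub T₀).rpow_const (p := 1 / (1 - δ))
      (Or.inr hp)).const_mul c
    rw [hp1] at this
    exact this.congr_deriv (by simp only [hz']; ring)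
  have hz'cont : Continuous z' := by
    have : Continuous fun t : ℝ => (T₀ - t) ^ (δ / (1 - δ)) :=
      (continuous_const.sub continuous_id).rpow_const fun _ => Or.inr hq.le
    fun_prop
  have hzcont : Continuous z := continuous_iff_continuousAt.2 fun t => (hzderiv t).continuousAt
  have hycont : ContinuousOn y (Set.Icc 0 T₀) := by
    have hprim : ContinuousOn (fun t => y 0 + ∫ σ in (0 : ℝ)..t, y' σ) (Set.Icc 0 T₀) := by
      have := intervalIntegral.continuousOn_primitive_interval
        ((intervalIntegrable_iff').1 (hy'_int 0 T₀ le_rfl hT₀.le))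
      rw [Set.uIcc_of_le hT₀.le] at this
      exact continuousOn_const.add this
    exact hprim.congr fun t ht => hy_ftc 0 t le_rfl ht.1
  have hyT : y T₀ ≤ 0 := by
    have hw := nonpos_of_le_of_forall_Ioc_pos (w := fun t => y t - z t)
      (hycont.sub hzcont.continuousOn) (by
        rw [Real.mul_rpow hk.le hT₀.le, ← hc] at hy0
        simpa only [hz, sub_zero, sub_nonpos] using hy0) (fun s t hs hst ht hpos => ?_)
      (Set.right_mem_Icc.2 hT₀.le)
    · have : z T₀ = 0 := by
        simp only [hz, sub_self, Real.zero_rpow (one_div_pos.2 h1).ne', mul_zero]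
      simpa [this] using hw
    have hzint := intervalIntegral.integral_eq_sub_of_hasDerivAt (a := s) (b := t)
      (fun x _ => hzderiv x) (hz'cont.intervalIntegrable s t)
    have hmono : ∫ σ in s..t, y' σ ≤ ∫ σ in s..t, z' σ := by
      rw [intervalIntegral.integral_of_le hst, intervalIntegral.integral_of_le hst]
      refine setIntegral_mono_on_ae (hy'_int s t hs hst).1
        (hz'cont.intervalIntegrable s t).1 measurableSet_Ioc ?_
      filter_upwards [hode] with x hx hxst
      have hxT : 0 ≤ T₀ - x := sub_nonneg.2 (hxst.2.trans ht)
      have hlt : z x < y x := sub_pos.1 (hpos x hxst)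
      have hpow : z x ^ δ ≤ y x ^ δ := Real.rpow_le_rpow (by positivity) hlt.le hδ0.le
      have hx' := hx (hs.trans_lt hxst.1)
      rw [max_eq_left hxT, extinction_profile_ode hδ hα hxT] at hx'
      change y' x + α * y x ^ δ ≤ z' x + α * z x ^ δ at hx'
      linarith [mul_le_mul_of_nonneg_left hpow hα.le]
    have := hy_ftc s t hs hst
    linarith
  intro t ht
  have hmono : ∫ σ in T₀..t, y' σ ≤ 0 := by
    rw [intervalIntegral.integral_of_le ht]
    refine setIntegral_nonpos_ae measurableSet_Ioc ?_
    filter_upwards [hode] with x hx hxt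
    have hx0 : 0 < x := hT₀.trans hxt.1
    have hx' := hx hx0
    rw [max_eq_right (sub_nonpos.2 hxt.1.le), Real.zero_rpow hq.ne', mul_zero] at hx'
    linarith [mul_nonneg hα.le (Real.rpow_nonneg (hy_nonneg x hx0.le) δ)]
  have := hy_ftc T₀ t hT₀.le ht
  linarith [hy_nonneg t (hT₀.le.trans ht)]
end

section
/- Let T₀ > 0, α > 0 and δ ∈ (0,1). Let y, z : [0,T₀] → ℝ be locally absolutely continuous nonnegative functions (y, z ∈ W^{1,1}((0,T₀);ℝ), continuous on [0,T₀]) such that y(0) ≤ z(0) and y′(t) + α·y(t)^δ ≤ z′(t) + α·z(t)^δ for almost every t ∈ (0,T₀). Then y(t) ≤ z(t) for every t ∈ [0,T₀]. -/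
open MeasureTheory

theorem stmt14 (T₀ α δ : ℝ) (hT₀ : 0 < T₀) (hα : 0 < α) (hδ : δ ∈ Set.Ioo (0 : ℝ) 1)
    (y z y' z' : ℝ → ℝ)
    (hy_cont : ContinuousOn y (Set.Icc 0 T₀))
    (hz_cont : ContinuousOn z (Set.Icc 0 T₀))
    (hy_nonneg : ∀ t ∈ Set.Icc (0 : ℝ) T₀, 0 ≤ y t)
    (hz_nonneg : ∀ t ∈ Set.Icc (0 : ℝ) T₀, 0 ≤ z t)
    (hy'_int : ∀ s t : ℝ, 0 ≤ s → s ≤ t → t ≤ T₀ → IntervalIntegrable y' volume s t)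
    (hz'_int : ∀ s t : ℝ, 0 ≤ s → s ≤ t → t ≤ T₀ → IntervalIntegrable z' volume s t)
    (hy_ftc : ∀ s t : ℝ, 0 ≤ s → s ≤ t → t ≤ T₀ → y t = y s + ∫ σ in s..t, y' σ)
    (hz_ftc : ∀ s t : ℝ, 0 ≤ s → s ≤ t → t ≤ T₀ → z t = z s + ∫ σ in s..t, z' σ)
    (h0 : y 0 ≤ z 0)
    (hcmp : ∀ᵐ t : ℝ ∂volume, t ∈ Set.Ioo 0 T₀ →
        y' t + α * y t ^ δ ≤ z' t + α * z t ^ δ) :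
    ∀ t ∈ Set.Icc (0 : ℝ) T₀, y t ≤ z t := by
  intro t ht
  by_contra! hlt
  have hsub : Set.Icc 0 t ⊆ Set.Icc 0 T₀ := Set.Icc_subset_Icc_right ht.2
  have hclosed : IsClosed {u ∈ Set.Icc 0 t | y u ≤ z u} :=
    isClosed_Icc.isClosed_le (hy_cont.mono hsub) (hz_cont.mono hsub)
  have hcompact : IsCompact {u ∈ Set.Icc 0 t | y u ≤ z u} :=
    isCompact_Icc.of_isClosed_subset hclosed fun u hu => hu.1
  -- The last time `s ≤ t` at which `y ≤ z`.
  obtain ⟨s, ⟨⟨hs0, hst⟩, hs⟩, hmax⟩ :=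
    hcompact.exists_isGreatest ⟨0, ⟨le_rfl, ht.1⟩, h0⟩
  have hgt : ∀ u ∈ Set.Ioo s t, z u < y u := fun u hu => by
    by_contra! h
    exact absurd (hmax ⟨⟨hs0.trans hu.1.le, hu.2.le⟩, h⟩) (not_le.mpr hu.1)
  have hint : ∫ σ in s..t, y' σ ≤ ∫ σ in s..t, z' σ := by
    refine intervalIntegral.integral_mono_ae_restrict hst (hy'_int s t hs0 hst ht.2)
      (hz'_int s t hs0 hst ht.2) ?_
    rw [← Measure.restrict_congr_set Ioo_ae_eq_Icc]
    refine (ae_restrict_iff' measurableSet_Ioo).mpr ?_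
    filter_upwards [hcmp] with u hu hmem
    have huT : u ∈ Set.Ioo 0 T₀ := ⟨hs0.trans_lt hmem.1, hmem.2.trans_le ht.2⟩
    have hpow : z u ^ δ ≤ y u ^ δ :=
      Real.rpow_le_rpow (hz_nonneg u (Set.Ioo_subset_Icc_self huT)) (hgt u hmem).le hδ.1.le
    linarith [hu huT, mul_le_mul_of_nonneg_left hpow hα.le]
  linarith [hy_ftc s t hs0 hst ht.2, hz_ftc s t hs0 hst ht.2]
end
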